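/- arXiv:1602.04850 — 2 statements merged into one kernel-verified Lean document; each statement's English description precedes it below -/
import Mathlib

section
/- Let -1/2 < d < 0 and set a_h = Γ(h+d)/(Γ(d)·Γ(h+1)) for h ≥ 1. Then ∑_{h=1}^∞ a_h² + 2·∑_{h=1}^∞ a_h·∑_{i=1}^∞ a_i·a_{i+h} = (3Γ(−3d)Γ(−d) − d·Γ(−d)²·Γ(−2d) − 6Γ(−2d)²)/(−d·Γ(−2d)·Γ(−d)²). -/
open Filter Topology Real

lemma fx_prod (s : ℝ) (hs : ∀ n : ℕ, s ≠ -n) (n : ℕ) :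
    Gamma s * ∏ j ∈ Finset.range n, (s + j) = Gamma (s + n) := by
  induction n with
  | zero => simp
  | succ n ih =>
    rw [Finset.prod_range_succ, ← mul_assoc, ih]
    push_cast
    rw [← add_assoc, Real.Gamma_add_one, mul_comm]
    intro h; exact hs n (by linarith)

lemma fx_asymp (s : ℝ) (hs : ∀ n : ℕ, s ≠ -n) :
    Tendsto (fun n : ℕ => Gamma (s + n + 1) / ((n : ℝ) ^ s * Gamma (n + 1))) atTop (𝓝 1) := by
  have h0 := Real.Gamma_ne_zero hs
  have h1 : Tendsto (fun n : ℕ => Gamma s / GammaSeq s n) atTop (𝓝 (Gamma s / Gamma s)) :=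
    tendsto_const_nhds.div (GammaSeq_tendsto_Gamma s) h0
  rw [div_self h0] at h1
  refine h1.congr fun n => ?_
  have := fx_prod s hs (n + 1)
  push_cast at this
  rw [GammaSeq, div_div_eq_mul_div, this, Real.Gamma_nat_eq_factorial, add_assoc]

noncomputable def fxT (a b c : ℝ) (k : ℕ) : ℝ :=
  Gamma (a + k) * Gamma (b + k) / (Gamma (k + 1) * Gamma (c + k))

lemma fx_pos_ne {c : ℝ} (hc : 0 < c) (n : ℕ) : c ≠ -n := by
  have : (0 : ℝ) ≤ n := n.cast_nonneg
  intro h; linarith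

lemma fxT_asymp (a b c : ℝ) (ha : ∀ n : ℕ, a ≠ -n) (hb : ∀ n : ℕ, b ≠ -n) (hc : 0 < c) :
    Tendsto (fun n : ℕ => ((n : ℝ) + 1) * fxT a b c (n + 1) / (n : ℝ) ^ (a + b - c))
      atTop (𝓝 1) := by
  have h := ((fx_asymp a ha).mul (fx_asymp b hb)).div (fx_asymp c (fx_pos_ne hc)) one_ne_zero
  simp only [mul_one, div_one] at h
  refine h.congr' ?_
  filter_upwards [eventually_gt_atTop 0] with n hn
  have hn' : (0 : ℝ) < n := by exact_mod_cast hn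
  have e1 := (Real.rpow_pos_of_pos hn' a).ne'
  have e2 := (Real.rpow_pos_of_pos hn' b).ne'
  have e3 := (Real.rpow_pos_of_pos hn' c).ne'
  have e4 : Gamma (c + n + 1) ≠ 0 := (Real.Gamma_pos_of_pos (by positivity)).ne'
  have e5 : Gamma ((n : ℝ) + 1) ≠ 0 := (Real.Gamma_pos_of_pos (by positivity)).ne'
  have e6 : (n : ℝ) + 1 ≠ 0 := by positivity
  simp only [fxT, Pi.div_apply]
  push_cast
  rw [Real.Gamma_add_one e6, Real.rpow_sub hn', Real.rpow_add hn']
  simp only [← add_assoc]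
  field_simp

lemma fxT_bigO (a b c : ℝ) (ha : ∀ n : ℕ, a ≠ -n) (hb : ∀ n : ℕ, b ≠ -n) (hc : 0 < c) :
    (fun n : ℕ => ((n : ℝ) + 1) * fxT a b c (n + 1)) =O[atTop] (fun n : ℕ => (n : ℝ) ^ (a + b - c)) := by
  refine Asymptotics.isBigO_of_div_tendsto_nhds ?_ 1 (fxT_asymp a b c ha hb hc)
  filter_upwards [eventually_gt_atTop 0] with n hn h
  have hn' : (0 : ℝ) < n := by exact_mod_cast hn
  exact absurd h (Real.rpow_pos_of_pos hn' _).ne'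

lemma fxT_tendsto (a b c : ℝ) (ha : ∀ n : ℕ, a ≠ -n) (hb : ∀ n : ℕ, b ≠ -n) (hc : 0 < c)
    (h : 0 < c - a - b) : Tendsto (fun n : ℕ => (n : ℝ) * fxT a b c n) atTop (𝓝 0) := by
  rw [← tendsto_add_atTop_iff_nat 1]
  have := (fxT_bigO a b c ha hb hc).trans_tendsto (by
    have := (tendsto_rpow_neg_atTop h).comp (tendsto_natCast_atTop_atTop (R := ℝ))
    refine this.congr fun n => ?_
    simp only [Function.comp]
    congr 1; ring)
  simpa using this

lemma fxT_summable (a b c : ℝ) (ha : ∀ n : ℕ, a ≠ -n) (hb : ∀ n : ℕ, b ≠ -n) (hc : 0 < c)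
    (h : 0 < c - a - b) : Summable (fxT a b c) := by
  rw [← summable_nat_add_iff 1]
  have hs : Summable (fun n : ℕ => (n : ℝ) ^ (a + b - c - 1)) :=
    Real.summable_nat_rpow.2 (by linarith)
  refine summable_of_isBigO_nat hs ?_
  have h2 : (fun n : ℕ => ((n : ℝ) + 1)⁻¹) =O[atTop] (fun n : ℕ => (n : ℝ)⁻¹) := by
    refine Asymptotics.IsBigO.of_bound 1 ?_
    filter_upwards [eventually_gt_atTop 0] with n hn
    have hn' : (0 : ℝ) < n := by exact_mod_cast hn
    rw [Real.norm_of_nonneg (by positivity), Real.norm_of_nonneg (by positivity), one_mul]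
    gcongr; linarith
  refine (h2.mul (fxT_bigO a b c ha hb hc)).congr' ?_ ?_
  · filter_upwards with n
    have e6 : (n : ℝ) + 1 ≠ 0 := by positivity
    field_simp
  · filter_upwards [eventually_gt_atTop 0] with n hn
    have hn' : (0 : ℝ) < n := by exact_mod_cast hn
    rw [Real.rpow_sub_one hn'.ne']
    field_simp

lemma fxT_rec (a b c : ℝ) (ha : ∀ n : ℕ, a ≠ -n) (hb : ∀ n : ℕ, b ≠ -n) (hc : 0 < c) (k : ℕ) :
    (c - a - b) * fxT a b c k - (c - a) * (c - b) * fxT a b (c + 1) k =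
      (k : ℝ) * fxT a b c k - ((k + 1 : ℕ) : ℝ) * fxT a b c (k + 1) := by
  have hk : (0 : ℝ) ≤ k := k.cast_nonneg
  have e1 : Gamma (c + k) ≠ 0 := (Real.Gamma_pos_of_pos (by positivity)).ne'
  have e5 : Gamma ((k : ℝ) + 1) ≠ 0 := (Real.Gamma_pos_of_pos (by positivity)).ne'
  have e6 : (k : ℝ) + 1 ≠ 0 := by positivity
  have e7 : c + (k : ℝ) ≠ 0 := by positivity
  have e8 : a + (k : ℝ) ≠ 0 := fun h => ha k (by linarith)
  have e9 : b + (k : ℝ) ≠ 0 := fun h => hb k (by linarith)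
  simp only [fxT]
  push_cast
  rw [show c + 1 + (k : ℝ) = c + k + 1 by ring]
  simp only [← add_assoc]
  rw [Real.Gamma_add_one e6, Real.Gamma_add_one e7, Real.Gamma_add_one e8, Real.Gamma_add_one e9]
  field_simp
  ring

lemma fxT_tsum_rec (a b c : ℝ) (ha : ∀ n : ℕ, a ≠ -n) (hb : ∀ n : ℕ, b ≠ -n) (hc : 0 < c)
    (h : 0 < c - a - b) :
    (c - a - b) * ∑' k, fxT a b c k = (c - a) * (c - b) * ∑' k, fxT a b (c + 1) k := by
  have s1 := (fxT_summable a b c ha hb hc h).hasSum.mul_left (c - a - b)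
  have s2 := (fxT_summable a b (c + 1) ha hb (by linarith) (by linarith)).hasSum.mul_left
    ((c - a) * (c - b))
  have s3 := (s1.sub s2).tendsto_sum_nat
  have s4 : Tendsto (fun n : ℕ => ∑ i ∈ Finset.range n, ((c - a - b) * fxT a b c i -
      (c - a) * (c - b) * fxT a b (c + 1) i)) atTop (𝓝 0) := by
    have := (fxT_tendsto a b c ha hb hc h).neg
    rw [neg_zero] at this
    refine this.congr fun n => ?_
    rw [Finset.sum_congr rfl fun k _ => fxT_rec a b c ha hb hc k]
    rw [Finset.sum_range_sub' (fun k : ℕ => (k : ℝ) * fxT a b c k)]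
    simp
  linarith [tendsto_nhds_unique s3 s4]

lemma fx_ratio_le (c : ℝ) (hc : 0 < c) (m : ℝ) (hm : 0 ≤ m) (k : ℕ) :
    Gamma (c + m) / Gamma (c + m + k) ≤ Gamma c / Gamma (c + k) := by
  induction k with
  | zero =>
    have e1 : Gamma (c + m) ≠ 0 := (Real.Gamma_pos_of_pos (by positivity)).ne'
    have e2 : Gamma c ≠ 0 := (Real.Gamma_pos_of_pos (by positivity)).ne'
    simp [e1, e2]
  | succ k ih =>
    push_cast
    simp only [← add_assoc]
    rw [Real.Gamma_add_one (by positivity), Real.Gamma_add_one (by positivity),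
      mul_comm, ← div_div, mul_comm, ← div_div]
    have e2 : 0 < Gamma c := (Real.Gamma_pos_of_pos (by positivity))
    have e3 : 0 < Gamma (c + k) := (Real.Gamma_pos_of_pos (by positivity))
    gcongr
    linarith

lemma fx_ratio_tendsto (c : ℝ) (hc : 0 < c) (k : ℕ) :
    Tendsto (fun m : ℕ => Gamma (c + m) / Gamma (c + m + ((k + 1 : ℕ) : ℝ))) atTop (𝓝 0) := by
  have h1 : Tendsto (fun m : ℕ => Gamma c / Gamma (c + k) / (c + m)) atTop (𝓝 0) :=
    tendsto_const_nhds.div_atTop (tendsto_atTop_add_const_left _ _ tendsto_natCast_atTop_atTop)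
  refine squeeze_zero (fun m => ?_) (fun m => ?_) h1
  · exact div_nonneg (Real.Gamma_pos_of_pos (by positivity)).le
      (Real.Gamma_pos_of_pos (by positivity)).le
  · have e1 : 0 < Gamma (c + m) := (Real.Gamma_pos_of_pos (by positivity))
    have e2 : 0 < Gamma c := (Real.Gamma_pos_of_pos (by positivity))
    have e3 : 0 < Gamma (c + k) := (Real.Gamma_pos_of_pos (by positivity))
    have := fx_ratio_le c hc m (by positivity) k
    push_cast
    rw [← add_assoc, Real.Gamma_add_one (by positivity), mul_comm, ← div_div]
    have hk : (0 : ℝ) ≤ k := by positivity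
    have hle : c + (m : ℝ) ≤ c + m + k := by linarith
    exact div_le_div₀ (by positivity) this (by positivity) hle

lemma fxT_lim (a b c : ℝ) (ha : ∀ n : ℕ, a ≠ -n) (hb : ∀ n : ℕ, b ≠ -n) (hc : 0 < c)
    (h : 0 < c - a - b) :
    Tendsto (fun m : ℕ => Gamma (c + m) * ∑' k, fxT a b (c + m) k) atTop
      (𝓝 (Gamma a * Gamma b)) := by
  have key := tendsto_tsum_of_dominated_convergence (𝓕 := atTop)
    (f := fun (m : ℕ) (k : ℕ) => Gamma (c + m) * fxT a b (c + m) k)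
    (g := fun k => if k = 0 then Gamma a * Gamma b else 0)
    (bound := fun k => Gamma c * ‖fxT a b c k‖)
    ((fxT_summable a b c ha hb hc h).norm.mul_left _) ?_ ?_
  · rw [tsum_ite_eq] at key
    simpa only [tsum_mul_left] using key
  · intro k
    rcases k with _ | k
    · simp only [if_true]
      refine tendsto_const_nhds.congr fun m => ?_
      have e1 : Gamma (c + m) ≠ 0 := (Real.Gamma_pos_of_pos (by positivity)).ne'
      simp [fxT]
      field_simp
    · simp only [Nat.succ_ne_zero, if_false]
      have := (fx_ratio_tendsto c hc k).mul_const
        (Gamma (a + (k + 1 : ℕ)) * Gamma (b + (k + 1 : ℕ)) / Gamma ((k + 1 : ℕ) + 1))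
      rw [zero_mul] at this
      refine this.congr fun m => ?_
      rw [fxT]
      simp only [div_eq_mul_inv, mul_inv]
      ring
  · filter_upwards with m k
    have := fx_ratio_le c hc m (by positivity) k
    have e1 : 0 < Gamma (c + m) := (Real.Gamma_pos_of_pos (by positivity))
    have e2 : 0 < Gamma c := (Real.Gamma_pos_of_pos (by positivity))
    have e3 : 0 < Gamma (c + m + k) := (Real.Gamma_pos_of_pos (by positivity))
    have e4 : 0 < Gamma (c + k) := (Real.Gamma_pos_of_pos (by positivity))
    have r1 : Gamma (c + m) * fxT a b (c + m) k = Gamma (c + m) / Gamma (c + m + k) *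
        (Gamma (a + k) * Gamma (b + k) / Gamma (k + 1)) := by
      rw [fxT]; simp only [div_eq_mul_inv, mul_inv]; ring
    have r2 : Gamma c * ‖fxT a b c k‖ = Gamma c / Gamma (c + k) *
        ‖Gamma (a + k) * Gamma (b + k) / Gamma (k + 1)‖ := by
      rw [fxT, ← div_div, norm_div _ (Gamma (c + k)), Real.norm_of_nonneg e4.le]
      ring
    rw [r1, r2, norm_mul, Real.norm_of_nonneg (by positivity)]
    gcongr

noncomputable def fxV (a b c : ℝ) : ℝ := Gamma (c - a - b) / (Gamma (c - a) * Gamma (c - b))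

lemma fxV_lim (a b c : ℝ) (hc : 0 < c)
    (h : 0 < c - a - b) (hca : 0 < c - a) (hcb : 0 < c - b) :
    Tendsto (fun m : ℕ => Gamma (c + (m + 1 : ℕ)) * fxV a b (c + (m + 1 : ℕ))) atTop (𝓝 1) := by
  have h := ((fx_asymp c (fx_pos_ne hc)).mul (fx_asymp _ (fx_pos_ne h))).div
    ((fx_asymp _ (fx_pos_ne hca)).mul (fx_asymp _ (fx_pos_ne hcb))) (by norm_num)
  simp only [mul_one, div_one] at h
  refine h.congr' ?_
  filter_upwards [eventually_gt_atTop 0] with n hn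
  have hn' : (0 : ℝ) < n := by exact_mod_cast hn
  have e1 := (Real.rpow_pos_of_pos hn' a).ne'
  have e2 := (Real.rpow_pos_of_pos hn' b).ne'
  have e3 := (Real.rpow_pos_of_pos hn' c).ne'
  have e5 : Gamma ((n : ℝ) + 1) ≠ 0 := (Real.Gamma_pos_of_pos (by positivity)).ne'
  have e6 : Gamma (c - a + n + 1) ≠ 0 := (Real.Gamma_pos_of_pos (by positivity)).ne'
  have e7 : Gamma (c - b + n + 1) ≠ 0 := (Real.Gamma_pos_of_pos (by positivity)).ne'
  simp only [fxV, Pi.div_apply]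
  push_cast
  rw [show c + ((n : ℝ) + 1) - a - b = c - a - b + n + 1 by ring,
    show c + ((n : ℝ) + 1) - a = c - a + n + 1 by ring,
    show c + ((n : ℝ) + 1) - b = c - b + n + 1 by ring, ← add_assoc]
  simp only [Real.rpow_sub hn']
  field_simp

lemma fx_gauss (a b c : ℝ) (ha : ∀ n : ℕ, a ≠ -n) (hb : ∀ n : ℕ, b ≠ -n) (hc : 0 < c)
    (h : 0 < c - a - b) (hca : 0 < c - a) (hcb : 0 < c - b) :
    HasSum (fxT a b c) (Gamma a * Gamma b * Gamma (c - a - b) / (Gamma (c - a) * Gamma (c - b))) := by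
  have hV : ∀ m : ℕ, 0 < fxV a b (c + m) := fun m => by
    have hm : (0 : ℝ) ≤ m := m.cast_nonneg
    refine div_pos ?_ (mul_pos ?_ ?_) <;> exact Real.Gamma_pos_of_pos (by linarith)
  have hconst : ∀ m : ℕ, (∑' k, fxT a b (c + m) k) / fxV a b (c + m) =
      (∑' k, fxT a b c k) / fxV a b c := by
    intro m
    induction m with
    | zero => simp
    | succ m ih =>
      rw [← ih]
      have hm : (0 : ℝ) ≤ m := m.cast_nonneg
      have hr := fxT_tsum_rec a b (c + m) ha hb (by linarith) (by linarith)
      have v1 := hV m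
      have v2 := hV (m + 1)
      have p1 : 0 < c + m - a := by linarith
      have p2 : 0 < c + m - b := by linarith
      have p3 : 0 < c + m - a - b := by linarith
      push_cast at v2 ⊢
      rw [← add_assoc] at v2 ⊢
      have hv : (c + m - a - b) * fxV a b (c + m) =
          (c + m - a) * (c + m - b) * fxV a b (c + m + 1) := by
        have e1 := (Real.Gamma_pos_of_pos p1).ne'
        have e2 := (Real.Gamma_pos_of_pos p2).ne'
        rw [fxV, fxV, show c + (m : ℝ) + 1 - a - b = c + m - a - b + 1 by ring,
          show c + (m : ℝ) + 1 - a = c + m - a + 1 by ring,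
          show c + (m : ℝ) + 1 - b = c + m - b + 1 by ring,
          Real.Gamma_add_one p1.ne', Real.Gamma_add_one p2.ne', Real.Gamma_add_one p3.ne']
        field_simp
      rw [div_eq_div_iff v2.ne' v1.ne']
      have q : (c + m - a) * (c + m - b) * (c + m - a - b) ≠ 0 := by positivity
      apply mul_left_cancel₀ q
      linear_combination (c + m - a) * (c + m - b) * (∑' k, fxT a b (c + m + 1) k) * hv -
        (c + m - a) * (c + m - b) * fxV a b (c + m + 1) * hr
  have L := (((fxT_lim a b c ha hb hc h).comp (tendsto_add_atTop_nat 1)).div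
    (fxV_lim a b c hc h hca hcb) one_ne_zero)
  have L2 : Tendsto (fun _ : ℕ => (∑' k, fxT a b c k) / fxV a b c) atTop
      (𝓝 (Gamma a * Gamma b / 1)) := by
    refine L.congr fun m => ?_
    simp only [Pi.div_apply, Function.comp]
    rw [mul_div_mul_left, hconst]
    exact (Real.Gamma_pos_of_pos (by positivity)).ne'
  have E := tendsto_nhds_unique tendsto_const_nhds L2
  have v0 := hV 0
  simp only [Nat.cast_zero, add_zero] at v0
  rw [div_one, div_eq_iff v0.ne'] at E
  have := (fxT_summable a b c ha hb hc h).hasSum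
  rw [E, fxV, ← mul_div_assoc] at this
  exact this

theorem farima_square_sum_identity (d : ℝ) (hd1 : -(1 / 2) < d) (hd2 : d < 0)
    (a : ℕ → ℝ)
    (ha : ∀ h : ℕ, a h = Real.Gamma ((h : ℝ) + d) / (Real.Gamma d * Real.Gamma ((h : ℝ) + 1))) :
    (∑' h : ℕ, (a (h + 1)) ^ 2) +
      2 * ∑' h : ℕ, a (h + 1) * ∑' i : ℕ, a (i + 1) * a (i + 1 + (h + 1)) =
      (3 * Real.Gamma (-3 * d) * Real.Gamma (-d)
        - d * (Real.Gamma (-d)) ^ 2 * Real.Gamma (-2 * d)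
        - 6 * (Real.Gamma (-2 * d)) ^ 2) /
        (-d * Real.Gamma (-2 * d) * (Real.Gamma (-d)) ^ 2) := by
  have hne : ∀ h n : ℕ, (h : ℝ) + d ≠ -n := by
    intro h n e
    have e1 : ((h + n : ℕ) : ℝ) < 1 := by push_cast; linarith
    have e2 : h + n = 0 := by
      have : h + n < 1 := by exact_mod_cast e1
      omega
    have e3 : ((h + n : ℕ) : ℝ) = 0 := by rw [e2]; simp
    push_cast at e3
    linarith
  have hne0 : ∀ n : ℕ, d ≠ -n := by simpa using hne 0
  have g0 : Gamma d ≠ 0 := Real.Gamma_ne_zero hne0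
  have g1 : Gamma (1 - d) ≠ 0 := (Real.Gamma_pos_of_pos (by linarith)).ne'
  have g2 : Gamma (1 - 2 * d) ≠ 0 := (Real.Gamma_pos_of_pos (by linarith)).ne'
  have a0 : a 0 = 1 := by rw [ha]; simp [g0]
  have hc : ∀ h : ℕ, HasSum (fun i : ℕ => a i * a (i + h))
      (Gamma (h + d) * Gamma (1 - 2 * d) / (Gamma d * Gamma (h + 1 - d) * Gamma (1 - d))) := by
    intro h
    have hh : (0 : ℝ) ≤ h := h.cast_nonneg
    have := (fx_gauss d (h + d) (h + 1) hne0 (hne h) (by linarith) (by linarith) (by linarith)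
      (by linarith)).mul_left (1 / Gamma d ^ 2)
    have g3 : Gamma (h + 1 - d) ≠ 0 := (Real.Gamma_pos_of_pos (by linarith)).ne'
    convert! this using 1
    · ext i
      rw [ha, ha, fxT]
      push_cast
      rw [show (i : ℝ) + h + d = h + d + i by ring, show (i : ℝ) + h + 1 = h + 1 + i by ring,
        add_comm (i : ℝ) d]
      field_simp
    · rw [show (h : ℝ) + 1 - d - (h + d) = 1 - 2 * d by ring,
        show (h : ℝ) + 1 - (h + d) = 1 - d by ring]
      field_simp
  have hinner : ∀ h : ℕ, ∑' i : ℕ, a (i + 1) * a (i + 1 + (h + 1)) =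
      Gamma ((h + 1 : ℕ) + d) * Gamma (1 - 2 * d) /
        (Gamma d * Gamma ((h + 1 : ℕ) + 1 - d) * Gamma (1 - d)) - a (h + 1) := by
    intro h
    have := ((hasSum_nat_add_iff' 1).2 (hc (h + 1))).tsum_eq
    rw [this]
    simp [a0]
  have hsq : HasSum (fun h : ℕ => a (h + 1) ^ 2) (Gamma (1 - 2 * d) / Gamma (1 - d) ^ 2 - 1) := by
    have := (hasSum_nat_add_iff' 1).2 (hc 0)
    convert! this using 1
    · ext h; simp [sq]
    · simp [a0]
      field_simp
  have hT : HasSum (fun h : ℕ => a h * (Gamma (h + d) * Gamma (1 - 2 * d) /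
      (Gamma d * Gamma (h + 1 - d) * Gamma (1 - d))))
      (Gamma (1 - 3 * d) / (Gamma (1 - d) * Gamma (1 - 2 * d))) := by
    have := (fx_gauss d d (1 - d) hne0 hne0 (by linarith) (by linarith) (by linarith)
      (by linarith)).mul_left (Gamma (1 - 2 * d) / (Gamma d ^ 2 * Gamma (1 - d)))
    convert! this using 1
    · ext h
      rw [ha, fxT]
      rw [show (h : ℝ) + 1 - d = 1 - d + h by ring, add_comm (h : ℝ) d]
      field_simp
    · rw [show 1 - d - d - d = 1 - 3 * d by ring, show 1 - d - d = 1 - 2 * d by ring]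
      field_simp
  have hT1 := (hasSum_nat_add_iff' 1).2 hT
  have hS : HasSum (fun h : ℕ => a (h + 1) * ∑' i : ℕ, a (i + 1) * a (i + 1 + (h + 1)))
      (Gamma (1 - 3 * d) / (Gamma (1 - d) * Gamma (1 - 2 * d)) -
        Gamma (1 - 2 * d) / Gamma (1 - d) ^ 2 -
        (Gamma (1 - 2 * d) / Gamma (1 - d) ^ 2 - 1)) := by
    convert! hT1.sub hsq using 1
    · ext h
      rw [hinner]
      ring
    · simp [a0]
      field_simp
  rw [hsq.tsum_eq, hS.tsum_eq]
  rw [show 1 - 3 * d = -3 * d + 1 by ring, show 1 - 2 * d = -2 * d + 1 by ring,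
    show 1 - d = -d + 1 by ring, Real.Gamma_add_one (by linarith), Real.Gamma_add_one (by linarith),
    Real.Gamma_add_one (by linarith)]
  have k1 : Gamma (-d) ≠ 0 := (Real.Gamma_pos_of_pos (by linarith)).ne'
  have k2 : Gamma (-2 * d) ≠ 0 := (Real.Gamma_pos_of_pos (by linarith)).ne'
  have k3 : d ≠ 0 := hd2.ne
  generalize Gamma (-2 * d) = y at *
  generalize Gamma (-3 * d) = z at *
  generalize Gamma (-d) = x at *
  field_simp
  ring
end

section
/- Let -1/2 < d < 0 and a_h = Γ(h+d)/(Γ(d)·Γ(h+1)) for h ≥ 0. Then the spectral density of the squared process at frequency zero, f_K(0) = ∑_{i=0}^∞ a_i⁴·Var(ε²) + 4∑_{0≤i<j<∞} a_i²a_j² + 2∑_{h=1}^∞ ∑_{i=0}^∞ a_i²a_{h+i}²·Var(ε²) + 8∑_{h=1}^∞ ∑_{0≤i<j<∞} a_i a_{h+i} a_j a_{h+j}, is strictly positive, where Var(ε²) ≥ 0 and a_0 = 1. -/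
theorem aux_neg_le_tsum {ι : Type*} (f : ι → ℝ) (C : ℝ) (hC : 0 ≤ C)
    (h : ∀ s : Finset ι, -C ≤ ∑ i ∈ s, f i) : -C ≤ ∑' i, f i := by
  by_cases hf : Summable f
  · exact ge_of_tendsto' hf.hasSum h
  · rw [tsum_eq_zero_of_not_summable hf]; linarith

noncomputable def auxH (n : ℕ) : ℝ := ∑ k ∈ Finset.range n, 1 / ((k : ℝ) + 1)

theorem auxH_nonneg (n : ℕ) : 0 ≤ auxH n := Finset.sum_nonneg fun k _ => by positivity

theorem auxH_succ (n : ℕ) : auxH (n + 1) = auxH n + 1 / ((n : ℝ) + 1) := by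
  unfold auxH; rw [Finset.sum_range_succ]

theorem auxH_inner (h N : ℕ) (hh : 0 < h) :
    ∑ j ∈ Finset.range N, 1 / (((j : ℝ) + 1) * ((j : ℝ) + 1 + h)) ≤ auxH h / h := by
  have hpos : (0 : ℝ) < h := by exact_mod_cast hh
  have key : ∀ N : ℕ, ∑ j ∈ Finset.range N, 1 / (((j : ℝ) + 1) * ((j : ℝ) + 1 + h))
      = (auxH N + auxH h - auxH (N + h)) / h := by
    intro N
    induction N with
    | zero => simp [auxH]
    | succ n ih =>
      rw [Finset.sum_range_succ, ih, show n + 1 + h = (n + h) + 1 by ring, auxH_succ, auxH_succ]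
      push_cast
      have h1 : (n : ℝ) + 1 ≠ 0 := by positivity
      have h2 : (n : ℝ) + 1 + h ≠ 0 := by positivity
      have h3 : (n : ℝ) + h + 1 ≠ 0 := by positivity
      field_simp
      ring
  rw [key]
  have : auxH N ≤ auxH (N + h) := by
    unfold auxH
    apply Finset.sum_le_sum_of_subset_of_nonneg
    · intro x; simp; omega
    · intros; positivity
  gcongr
  linarith

theorem auxH_outer (M : ℕ) :
    ∑ h ∈ Finset.range M, auxH (h + 1) / ((h : ℝ) + 1) ^ 2 ≤ 21 / 8 := by
  have key : ∀ M : ℕ, ∑ h ∈ Finset.range (M + 2), auxH (h + 1) / ((h : ℝ) + 1) ^ 2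
      ≤ 21 / 8 - (auxH (M + 2) + 1) / ((M : ℝ) + 2) := by
    intro M
    induction M with
    | zero => simp [Finset.sum_range_succ, auxH]; norm_num
    | succ n ih =>
      rw [Finset.sum_range_succ]
      refine (add_le_add_left ih _).trans ?_
      rw [auxH_succ (n + 2)]
      have h0 := auxH_nonneg (n + 2)
      generalize auxH (n + 2) = x at *
      push_cast
      have : 21 / 8 - (x + 1 / ((n : ℝ) + 2 + 1) + 1) / ((n : ℝ) + 1 + 2)
          - (21 / 8 - (x + 1) / ((n : ℝ) + 2) + (x + 1 / ((n : ℝ) + 2 + 1)) / ((n : ℝ) + 2 + 1) ^ 2)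
          = (x * (n + 3) + 1) / (((n : ℝ) + 2) * ((n : ℝ) + 3) ^ 3) := by
        have h1 : (n : ℝ) + 2 ≠ 0 := by positivity
        have h2 : (n : ℝ) + 3 ≠ 0 := by positivity
        rw [show (n : ℝ) + 2 + 1 = n + 3 by ring, show (n : ℝ) + 1 + 2 = n + 3 by ring]
        field_simp
        ring
      have h2 : 0 ≤ (x * (n + 3) + 1) / (((n : ℝ) + 2) * ((n : ℝ) + 3) ^ 3) := by positivity
      linarith
  have h1 := key M
  have h2 : ∑ h ∈ Finset.range M, auxH (h + 1) / ((h : ℝ) + 1) ^ 2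
      ≤ ∑ h ∈ Finset.range (M + 2), auxH (h + 1) / ((h : ℝ) + 1) ^ 2 := by
    apply Finset.sum_le_sum_of_subset_of_nonneg
    · intro x; simp; omega
    · intro i _ _
      have := auxH_nonneg (i + 1)
      positivity
  have h3 : 0 ≤ (auxH (M + 2) + 1) / ((M : ℝ) + 2) := by
    have := auxH_nonneg (M + 2)
    positivity
  linarith


theorem farima_square_spectral_density_pos (d v : ℝ) (hd1 : -(1 / 2) < d) (hd2 : d < 0)
    (hv : 0 ≤ v)
    (a : ℕ → ℝ)
    (ha : ∀ h : ℕ, a h = Real.Gamma ((h : ℝ) + d) / (Real.Gamma d * Real.Gamma ((h : ℝ) + 1)))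
    (ha0 : a 0 = 1) :
    0 < (∑' i : ℕ, (a i) ^ 4 * v)
        + 4 * (∑' p : {p : ℕ × ℕ // p.1 < p.2}, (a (p : ℕ × ℕ).1) ^ 2 * (a (p : ℕ × ℕ).2) ^ 2)
        + 2 * (∑' h : ℕ, ∑' i : ℕ, (a i) ^ 2 * (a ((h + 1) + i)) ^ 2 * v)
        + 8 * (∑' h : ℕ, ∑' p : {p : ℕ × ℕ // p.1 < p.2},
            a (p : ℕ × ℕ).1 * a ((h + 1) + (p : ℕ × ℕ).1)
              * a (p : ℕ × ℕ).2 * a ((h + 1) + (p : ℕ × ℕ).2)) := by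

  obtain ⟨s, rfl⟩ : ∃ s, d = -s := ⟨-d, by ring⟩
  have hs0 : 0 < s := by linarith
  have hs1 : s < 1 / 2 := by linarith
  have hrec : ∀ n : ℕ, a (n + 1) * ((n : ℝ) + 1) = a n * (n - s) := by
    intro n
    have hne : (n : ℝ) + -s ≠ 0 := by
      rcases Nat.eq_zero_or_pos n with h | h
      · subst h; simp; linarith
      · have : (1 : ℝ) ≤ n := by exact_mod_cast h
        linarith
    have hn1 : (n : ℝ) + 1 ≠ 0 := by positivity
    rw [ha, ha]
    push_cast
    rw [show (n : ℝ) + 1 + -s = (n + -s) + 1 by ring, Real.Gamma_add_one hne, Real.Gamma_add_one hn1]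
    by_cases hg : Real.Gamma (-s) = 0
    · simp [hg]
    have hg2 : Real.Gamma ((n : ℝ) + 1) ≠ 0 := (Real.Gamma_pos_of_pos (by positivity)).ne'
    field_simp
    ring
  have ha1 : a 1 = -s := by
    have := hrec 0
    simp [ha0] at this
    exact this
  -- a (n+1) ≤ 0
  have hneg : ∀ n : ℕ, a (n + 1) ≤ 0 := by
    intro n
    induction n with
    | zero => simp [ha1]; linarith
    | succ n ih =>
      have h := hrec (n + 1)
      push_cast at h
      have h1 : (0 : ℝ) ≤ n := by positivity
      have h2 : a (n + 1) * ((n : ℝ) + 1 - s) ≤ 0 := mul_nonpos_of_nonpos_of_nonneg ih (by linarith)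
      by_contra hc
      push Not at hc
      have : 0 < a (n + 1 + 1) * ((n : ℝ) + 1 + 1) := by positivity
      linarith
  have hb2 : ∀ n : ℕ, -a (n + 2) ≤ s * (1 - s) / ((n : ℝ) + 2) := by
    intro n
    rw [le_div_iff₀ (by positivity)]
    induction n with
    | zero =>
      have h := hrec 1
      rw [ha1] at h
      norm_num at h ⊢
      linarith
    | succ n ih =>
      have h := hrec (n + 2)
      push_cast at h ⊢
      have h3 := mul_nonneg hs0.le (neg_nonneg.2 (hneg (n + 1)))
      rw [show n + 1 + 1 = n + 2 by ring] at h3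
      rw [show n + 1 + 2 = n + 2 + 1 by ring, show (n : ℝ) + 1 + 2 = n + 2 + 1 by ring]
      nlinarith
  have hb1 : ∀ n : ℕ, -a (n + 1) ≤ s / ((n : ℝ) + 1) := by
    intro n
    cases n with
    | zero => simp [ha1]
    | succ n =>
      refine (hb2 n).trans ?_
      push_cast
      rw [show (n : ℝ) + 1 + 1 = n + 2 by ring]
      gcongr
      nlinarith
  -- triple product bound
  have htri : ∀ h j : ℕ, (-a (h + 1)) * (-a (j + 1)) * (-a (h + 1 + (j + 1)))
      ≤ s ^ 3 * (1 - s) ^ 2 / ((h : ℝ) + 1) * (1 / (((j : ℝ) + 1) * ((j : ℝ) + 1 + (h + 1 : ℕ))))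
        + (if h = 0 then (if j = 0 then s ^ 4 * (1 - s) / 2 else 0) else 0) := by
    intro h j
    have x0 := neg_nonneg.2 (hneg h)
    have y0 := neg_nonneg.2 (hneg j)
    have z0 := neg_nonneg.2 (hneg (h + j + 1))
    have z1 := hb2 (h + j)
    rw [show h + 1 + (j + 1) = h + j + 2 by ring]
    rw [show h + j + 1 + 1 = h + j + 2 by ring] at z0
    have hs' : 0 < 1 - s := by linarith
    push_cast at z1 ⊢
    by_cases hh : h = 0
    · subst hh
      by_cases hj : j = 0
      · subst hj
        simp [ha1] at z1 ⊢
        have : s * s * (-a 2) ≤ s * s * (s * (1 - s) / 2) := by gcongr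
        have e : s ^ 3 * (1 - s) ^ 2 * (1 + 1)⁻¹ + s ^ 4 * (1 - s) / 2 = s * s * (s * (1 - s) / 2) := by
          norm_num; ring
        linarith
      · obtain ⟨k, rfl⟩ := Nat.exists_eq_succ_of_ne_zero hj
        have y1 := hb2 k
        have x1 := hb1 0
        have : (-a (0 + 1)) * (-a (k + 1 + 1)) * (-a (0 + (k + 1) + 2)) ≤
          (s / (((0:ℕ):ℝ) + 1)) * (s * (1 - s) / ((k : ℝ) + 2)) * (s * (1 - s) / (((0:ℕ):ℝ) + ((k + 1 : ℕ) : ℝ) + 2)) := by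
          gcongr
        refine this.trans (le_of_eq ?_)
        simp
        field_simp
        ring
    · obtain ⟨k, rfl⟩ := Nat.exists_eq_succ_of_ne_zero hh
      have x1 := hb2 k
      have y1 := hb1 j
      have : (-a (k + 1 + 1)) * (-a (j + 1)) * (-a (k + 1 + j + 2)) ≤
          (s * (1 - s) / ((k : ℝ) + 2)) * (s / ((j : ℝ) + 1)) * (s * (1 - s) / (((k + 1 : ℕ) : ℝ) + j + 2)) := by
        gcongr
      refine this.trans (le_of_eq ?_)
      simp
      field_simp
      ring
  set D : ℕ → ℝ := fun h => s ^ 3 * (1 - s) ^ 2 * (auxH (h + 1) / ((h : ℝ) + 1) ^ 2)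
      + (if h = 0 then s ^ 4 * (1 - s) / 2 else 0) with hD
  have hs' : 0 < 1 - s := by linarith
  have hD0 : ∀ h, 0 ≤ D h := by
    intro h
    have := auxH_nonneg (h + 1)
    simp only [hD]
    split_ifs <;> positivity
  have hrow : ∀ h N : ℕ, ∑ j ∈ Finset.range N,
      (-a (h + 1)) * (-a (j + 1)) * (-a (h + 1 + (j + 1))) ≤ D h := by
    intro h N
    refine (Finset.sum_le_sum fun j _ => htri h j).trans ?_
    rw [Finset.sum_add_distrib, ← Finset.mul_sum]
    simp only [hD]
    apply add_le_add
    · refine (mul_le_mul_of_nonneg_left (auxH_inner (h + 1) N (by omega)) (by positivity)).trans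
        (le_of_eq ?_)
      push_cast
      field_simp
    · split_ifs
      · rw [Finset.sum_ite_eq']
        split_ifs
        · exact le_rfl
        · positivity
      · simp
  have hinner : ∀ h : ℕ, -D h ≤ ∑' p : {p : ℕ × ℕ // p.1 < p.2},
            a (p : ℕ × ℕ).1 * a ((h + 1) + (p : ℕ × ℕ).1)
              * a (p : ℕ × ℕ).2 * a ((h + 1) + (p : ℕ × ℕ).2) := by
    intro h
    apply aux_neg_le_tsum _ _ (hD0 h)
    intro S
    set f : {p : ℕ × ℕ // p.1 < p.2} → ℝ := fun p => a (p : ℕ × ℕ).1 * a ((h + 1) + (p : ℕ × ℕ).1)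
              * a (p : ℕ × ℕ).2 * a ((h + 1) + (p : ℕ × ℕ).2) with hf
    set t : ℕ → ℝ := fun j => (-a (h + 1)) * (-a (j + 1)) * (-a (h + 1 + (j + 1))) with ht
    have ht0 : ∀ j, 0 ≤ t j := by
      intro j
      have x0 := neg_nonneg.2 (hneg h)
      have y0 := neg_nonneg.2 (hneg j)
      have z0 := neg_nonneg.2 (hneg (h + 1 + j))
      exact mul_nonneg (mul_nonneg x0 y0) z0
    have hsplit := Finset.sum_filter_add_sum_filter_not S (fun p : {p : ℕ × ℕ // p.1 < p.2} => p.1.1 = 0) f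
    have hB : 0 ≤ ∑ p ∈ S with ¬ p.1.1 = 0, f p := by
      apply Finset.sum_nonneg
      rintro ⟨⟨i, j⟩, hij⟩ hp
      simp only [Finset.mem_filter] at hp
      obtain ⟨i, rfl⟩ := Nat.exists_eq_succ_of_ne_zero hp.2
      obtain ⟨j, rfl⟩ := Nat.exists_eq_succ_of_ne_zero (show j ≠ 0 by simp at hij; omega)
      have e1 := hneg i
      have e2 := hneg (h + 1 + i)
      have e3 := hneg j
      have e4 := hneg (h + 1 + j)
      have := mul_nonneg (mul_nonneg_of_nonpos_of_nonpos e1 e2) (mul_nonneg_of_nonpos_of_nonpos e3 e4)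
      simp only [hf]
      rw [mul_assoc]
      exact this
    have hA : ∑ p ∈ S with p.1.1 = 0, f p
        = -∑ j ∈ (S.filter (fun p : {p : ℕ × ℕ // p.1 < p.2} => p.1.1 = 0)).image (fun p : {p : ℕ × ℕ // p.1 < p.2} => p.1.2 - 1), t j := by
      rw [Finset.sum_image, ← Finset.sum_neg_distrib]
      · apply Finset.sum_congr rfl
        rintro ⟨⟨i, j⟩, hij⟩ hp
        simp only [Finset.mem_filter] at hp
        obtain ⟨_, rfl⟩ := hp
        obtain ⟨j, rfl⟩ := Nat.exists_eq_succ_of_ne_zero (show j ≠ 0 by simp at hij; omega)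
        simp [hf, ht, ha0]
      · rintro ⟨⟨i, j⟩, hij⟩ hp ⟨⟨i', j'⟩, hij'⟩ hp' he
        simp at hp hp' he hij hij' ⊢
        omega
    obtain ⟨N, hN⟩ := Finset.exists_nat_subset_range
      ((S.filter (fun p : {p : ℕ × ℕ // p.1 < p.2} => p.1.1 = 0)).image (fun p : {p : ℕ × ℕ // p.1 < p.2} => p.1.2 - 1))
    have hle := Finset.sum_le_sum_of_subset_of_nonneg hN (fun j _ _ => ht0 j)
    have := hrow h N
    linarith
  have houter : -(s ^ 3 * (1 - s) ^ 2 * (21 / 8) + s ^ 4 * (1 - s) / 2) ≤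
      ∑' h : ℕ, ∑' p : {p : ℕ × ℕ // p.1 < p.2},
            a (p : ℕ × ℕ).1 * a ((h + 1) + (p : ℕ × ℕ).1)
              * a (p : ℕ × ℕ).2 * a ((h + 1) + (p : ℕ × ℕ).2) := by
    apply aux_neg_le_tsum _ _ (by positivity)
    intro S
    refine le_trans ?_ (Finset.sum_le_sum fun h _ => hinner h)
    rw [Finset.sum_neg_distrib, neg_le_neg_iff]
    obtain ⟨N, hN⟩ := Finset.exists_nat_subset_range S
    refine (Finset.sum_le_sum_of_subset_of_nonneg hN (fun j _ _ => hD0 j)).trans ?_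
    simp only [hD]
    rw [Finset.sum_add_distrib, ← Finset.mul_sum]
    apply add_le_add
    · exact mul_le_mul_of_nonneg_left (auxH_outer N) (by positivity)
    · rw [Finset.sum_ite_eq']
      split_ifs
      · exact le_rfl
      · positivity
  have hsq : Summable fun n => (a n) ^ 2 := by
    rw [← summable_nat_add_iff 1]
    have hz : Summable fun n : ℕ => s ^ 2 * (1 / (((n + 1 : ℕ) : ℝ)) ^ 2) :=
      ((summable_nat_add_iff 1).2 (Real.summable_one_div_nat_pow.2 one_lt_two)).mul_left _
    refine Summable.of_nonneg_of_le (fun n => sq_nonneg _) (fun n => ?_) hz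
    have h1 := hb1 n
    have h0 := neg_nonneg.2 (hneg n)
    calc a (n + 1) ^ 2 = (-a (n + 1)) ^ 2 := by ring
      _ ≤ (s / ((n : ℝ) + 1)) ^ 2 := by gcongr
      _ = _ := by push_cast; field_simp
  have hfirst : s ^ 2 ≤ ∑' p : {p : ℕ × ℕ // p.1 < p.2},
      (a (p : ℕ × ℕ).1) ^ 2 * (a (p : ℕ × ℕ).2) ^ 2 := by
    have hsum : Summable fun p : ℕ × ℕ => (a p.1) ^ 2 * (a p.2) ^ 2 :=
      hsq.mul_of_nonneg hsq (fun _ => sq_nonneg _) (fun _ => sq_nonneg _)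
    have hsum' := hsum.subtype {p : ℕ × ℕ | p.1 < p.2}
    have := hsum'.le_tsum (⟨(0, 1), by simp⟩ : {p : ℕ × ℕ // p.1 < p.2})
      (fun p _ => by simp only [Function.comp]; positivity)
    simp [ha0, ha1] at this
    exact this
  have hv1 : 0 ≤ ∑' i : ℕ, (a i) ^ 4 * v := tsum_nonneg fun i => by positivity
  have hv2 : 0 ≤ ∑' h : ℕ, ∑' i : ℕ, (a i) ^ 2 * (a ((h + 1) + i)) ^ 2 * v :=
    tsum_nonneg fun h => tsum_nonneg fun i => by positivity
  have hpoly : 0 < s ^ 2 - 2 * (s ^ 3 * (1 - s) ^ 2 * (21 / 8) + s ^ 4 * (1 - s) / 2) := by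
    have : 0 < 1 - (s * (1 - s) ^ 2 * (21 / 4) + s ^ 2 * (1 - s)) := by
      nlinarith [mul_nonneg hs0.le (sq_nonneg (s - 7 / 20)), sq_nonneg (s - 7 / 20), mul_pos hs0 hs']
    have := mul_pos (pow_pos hs0 2) this
    nlinarith
  linarith
end
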